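/- The 'if' direction of the ordinal representation theorem, plausibilistic case: let D_1 = ((A,S,C), E_1, u_1, Pl_1) be a plausibilistic decision problem with utility domain (U_1, ≤_{U_1}) and plausibility domain (P_1, ≤_{P_1}), and let ⪯ be a reflexive binary relation on A that weakly respects utility: for all constant acts a_{c_1}, a_{c_2} ∈ A (where a_c(s) = c for all s), a_{c_1} ⪯ a_{c_2} iff u_1(c_1) ≤_{U_1} u_1(c_2). Then there exist an expectation domain E_2 = (U_2, P_2, V, ⊗, ⊕) in which the plausibility domain P_2 is only required to be preordered (a reflexive transitive relation ≤_{P_2}, not necessarily antisymmetric, with bottom and top elements), a utility function u_2 : C → U_2 representing the same ordinal tastes as u_1 (for all c, d ∈ C: u_2(c) ≤_{U_2} u_2(d) iff u_1(c) ≤_{U_1} u_1(d)), and a plausibility measure Pl_2 : 2^S → P_2 representing the same ordinal beliefs as Pl_1 (for all X, Y ⊆ S: Pl_2(X) ≤_{P_2} Pl_2(Y) iff Pl_1(X) ≤_{P_1} Pl_1(Y)), such that GEU(((A,S,C), E_2, u_2, Pl_2)) = ⪯. -/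

import Mathlib

open Classical

noncomputable section

universe u v w x y z

/-- An expectation domain `E = (U, P, V, ⊗, ⊕)` whose plausibility domain `(P, leP)` is
only required to be *preordered* (reflexive and transitive, not necessarily
antisymmetric), with bottom and top elements: a utility domain `(U, leU)` with a
reflexive relation, a valuation domain `(V, leV)` with a reflexive relation,
`⊗ : P × U → V`, `⊕ : V × V → V` associative and commutative, `⊤ ⊗ u = u` (via the
embedding `iota` of `U` into `V`), and `(U, leU)` a substructure of `(V, leV)`. -/
structure GExpectationDomain (U : Type w) (P : Type x) (V : Type y) where
  leU : U → U → Prop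
  leU_refl : ∀ a, leU a a
  leP : P → P → Prop
  leP_refl : ∀ p, leP p p
  leP_trans : ∀ p q r, leP p q → leP q r → leP p r
  bot : P
  top : P
  bot_le : ∀ p, leP bot p
  le_top : ∀ p, leP p top
  leV : V → V → Prop
  leV_refl : ∀ v, leV v v
  otimes : P → U → V
  oplus : V → V → V
  oplus_assoc : ∀ a b c, oplus (oplus a b) c = oplus a (oplus b c)
  oplus_comm : ∀ a b, oplus a b = oplus b a
  iota : U → V
  iota_injective : Function.Injective iota
  top_otimes : ∀ a, otimes top a = iota a
  leV_iota : ∀ a b, leV (iota a) (iota b) ↔ leU a b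

/-- `Pl : 2^S → P` is a plausibility measure: `Pl ∅ = ⊥`, `Pl S = ⊤`, and `Pl` is monotone. -/
def IsPlausMeasure {S : Type u} {U : Type w} {P : Type x} {V : Type y}
    (E : GExpectationDomain U P V) (Pl : Set S → P) : Prop :=
  Pl ∅ = E.bot ∧ Pl Set.univ = E.top ∧ ∀ X Y : Set S, X ⊆ Y → E.leP (Pl X) (Pl Y)

/-- A simple act: a function from states to consequences with finite range. -/
def SimpleAct (S : Type u) (C : Type v) : Type (max u v) :=
  {a : S → C // (Set.range a).Finite}

theorem SimpleAct.utility_range_finite {S : Type u} {C : Type v} {U : Type w}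
    (u : C → U) (a : SimpleAct S C) :
    (Set.range fun s => u (a.1 s)).Finite := by
  have h := a.2.image u
  have h2 : (Set.range fun s => u (a.1 s)) = u '' Set.range a.1 := by
    rw [← Set.range_comp]; rfl
  rw [h2]; exact h

/-- Generalized expected utility `⊕_{x ∈ ran f} Pl(f⁻¹(x)) ⊗ x` of a finite-range utility
random variable `f : S → U`. -/
def GExpectationDomain.geu {S : Type u} {U : Type w} {P : Type x} {V : Type y}
    (E : GExpectationDomain U P V) (Pl : Set S → P) (f : S → U)
    (hf : (Set.range f).Finite) (hS : Nonempty S) : V :=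
  letI := Classical.decEq U
  letI : Std.Commutative E.oplus := ⟨E.oplus_comm⟩
  letI : Std.Associative E.oplus := ⟨E.oplus_assoc⟩
  let g : U → V := fun z => E.otimes (Pl (f ⁻¹' {z})) z
  have hne : hf.toFinset.Nonempty :=
    ⟨f (Classical.choice hS), hf.mem_toFinset.mpr (Set.mem_range_self _)⟩
  (hf.toFinset.erase hne.choose).fold E.oplus (g hne.choose) g

/-- The generalized expected utility of a simple act. -/
def geuVal {S : Type u} {C : Type v} {U : Type w} {P : Type x} {V : Type y}
    [hS : Nonempty S] (E : GExpectationDomain U P V) (Pl : Set S → P)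
    (u : C → U) (a : SimpleAct S C) : V :=
  E.geu Pl (fun s => u (a.1 s)) (SimpleAct.utility_range_finite u a) hS

/-- The GEU preference relation on acts. -/
def geuRel {S : Type u} {C : Type v} {U : Type w} {P : Type x} {V : Type y}
    [Nonempty S] (E : GExpectationDomain U P V) (Pl : Set S → P)
    (u : C → U) (a₁ a₂ : SimpleAct S C) : Prop :=
  E.leV (geuVal E Pl u a₁) (geuVal E Pl u a₂)

theorem Finset.mem_fold_union_iff {α β : Type*} (op : Set α → Set α → Set α)
    [Std.Commutative op] [Std.Associative op] (hop : ∀ x y, op x y = x ∪ y)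
    (b : Set α) (g : β → Set α) (t : Finset β) (p : α) :
    p ∈ t.fold op b g ↔ p ∈ b ∨ ∃ z ∈ t, p ∈ g z := by
  induction t using Finset.induction_on with
  | empty => simp
  | insert z t hz ih =>
    rw [Finset.fold_insert hz, hop, Set.mem_union, ih]
    simp only [Finset.mem_insert, exists_eq_or_imp]
    tauto

/-- If `⊕` is union and `⊗` forms rectangles, the generalized expected utility of `f` is the
graph of `f`. -/
theorem GExpectationDomain.geu_eq_graph {S : Type u} {U : Type w} {P : Type x}
    (E : GExpectationDomain U P (Set (S × U))) (Pl : Set S → P)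
    (hoplus : ∀ x y, E.oplus x y = x ∪ y)
    (hotimes : ∀ X c, E.otimes (Pl X) c = X ×ˢ {c})
    (f : S → U) (hf : (Set.range f).Finite) (hS : Nonempty S) :
    E.geu Pl f hf hS = {p | f p.1 = p.2} := by
  ext ⟨s, c⟩
  unfold GExpectationDomain.geu
  have : Std.Commutative E.oplus := ⟨E.oplus_comm⟩
  have : Std.Associative E.oplus := ⟨E.oplus_assoc⟩
  extract_lets g hne
  rw [Finset.mem_fold_union_iff _ hoplus]
  have hg : ∀ z, (s, c) ∈ g z ↔ f s = z ∧ c = z := by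
    intro z
    simp [g, hotimes]
  simp only [hg, Finset.mem_erase, Set.Finite.mem_toFinset, Set.mem_range, Set.mem_ofPred_eq]
  constructor
  · rintro (⟨h, h'⟩ | ⟨z, -, h, h'⟩) <;> exact h.trans h'.symm
  · intro h
    by_cases hc : c = hne.choose
    · exact Or.inl ⟨h.trans hc, hc⟩
    · exact Or.inr ⟨c, ⟨hc, s, h⟩, h, rfl⟩

/-- The 'if' direction of the ordinal representation theorem, plausibilistic case: if a
reflexive relation `r` on the acts of a plausibilistic decision problem `D₁` (whose
plausibility domain is partially ordered) weakly respects utility (constant acts are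
related as the utilities of their consequences are related), then there are an expectation
domain `E₂` whose plausibility domain need only be preordered, a utility function `u₂`
representing the same ordinal tastes as `u₁`, and a plausibility measure `Pl₂`
representing the same ordinal beliefs as `Pl₁`, such that the GEU ordering of
`((A,S,C), E₂, u₂, Pl₂)` is exactly `r`. -/
theorem ordinal_geu_representation_if {S : Type u} {C : Type v} {U₁ : Type w}
    {P₁ : Type x} {V₁ : Type y} [Nonempty S]
    (E₁ : GExpectationDomain U₁ P₁ V₁)
    (hanti : ∀ p q : P₁, E₁.leP p q → E₁.leP q p → p = q)
    (Pl₁ : Set S → P₁) (hPl₁ : IsPlausMeasure E₁ Pl₁)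
    (u₁ : C → U₁) (A : Set (SimpleAct S C))
    (r : SimpleAct S C → SimpleAct S C → Prop)
    (hrefl : ∀ a ∈ A, r a a)
    (hweak : ∀ a₁ ∈ A, ∀ a₂ ∈ A, ∀ c₁ c₂ : C,
      (∀ s, a₁.1 s = c₁) → (∀ s, a₂.1 s = c₂) →
      (r a₁ a₂ ↔ E₁.leU (u₁ c₁) (u₁ c₂))) :
    ∃ (U₂ : Type (max u v w x)) (P₂ : Type (max u v w x)) (V₂ : Type (max u v w x))
      (E₂ : GExpectationDomain U₂ P₂ V₂) (u₂ : C → U₂) (Pl₂ : Set S → P₂),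
      IsPlausMeasure E₂ Pl₂ ∧
      (∀ c d : C, E₂.leU (u₂ c) (u₂ d) ↔ E₁.leU (u₁ c) (u₁ d)) ∧
      (∀ X Y : Set S, E₂.leP (Pl₂ X) (Pl₂ Y) ↔ E₁.leP (Pl₁ X) (Pl₁ Y)) ∧
      ∀ a₁ ∈ A, ∀ a₂ ∈ A, (r a₁ a₂ ↔ geuRel E₂ Pl₂ u₂ a₁ a₂) := by
  obtain ⟨hbot, htop, hmono⟩ := hPl₁
  let U₂ : Type (max u v w x) := ULift.{max u w x} C
  let P₂ : Type (max u v w x) := ULift.{max v w x} (Set S)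
  let graph : SimpleAct S C → Set (S × U₂) := fun a => {p | ULift.up (a.1 p.1) = p.2}
  let cst : U₂ → Set (S × U₂) := fun c => Set.univ ×ˢ {c}
  have graph_inj : Function.Injective graph := by
    intro a b h
    refine Subtype.ext (funext fun s => ?_)
    have hs : (s, ULift.up (a.1 s)) ∈ graph b := h ▸ (rfl : ULift.up (a.1 s) = _)
    exact (congrArg ULift.down hs).symm
  have cst_inj : Function.Injective cst := by
    intro c d h
    obtain ⟨s⟩ := ‹Nonempty S›
    have hs : (s, c) ∈ cst d := h ▸ (by simp [cst])
    simpa [cst] using hs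
  have graph_eq_cst : ∀ a c, graph a = cst c → ∀ s, a.1 s = c.down := by
    intro a c h s
    have hs : (s, ULift.up (a.1 s)) ∈ cst c := h ▸ (rfl : ULift.up (a.1 s) = _)
    exact congrArg ULift.down (show ULift.up (a.1 s) = c by simpa [cst] using hs)
  let le : Set (S × U₂) → Set (S × U₂) → Prop := fun X Y =>
    X = Y ∨ (∃ c d, X = cst c ∧ Y = cst d ∧ E₁.leU (u₁ c.down) (u₁ d.down)) ∨
      ∃ a ∈ A, ∃ b ∈ A, X = graph a ∧ Y = graph b ∧ r a b
  let E₂ : GExpectationDomain U₂ P₂ (Set (S × U₂)) :=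
    { leU := fun c d => E₁.leU (u₁ c.down) (u₁ d.down)
      leU_refl := fun c => E₁.leU_refl _
      leP := fun X Y => E₁.leP (Pl₁ X.down) (Pl₁ Y.down)
      leP_refl := fun X => E₁.leP_refl _
      leP_trans := fun _ _ _ => E₁.leP_trans _ _ _
      bot := ⟨∅⟩
      top := ⟨Set.univ⟩
      bot_le := fun X => hmono _ _ (Set.empty_subset _)
      le_top := fun X => hmono _ _ (Set.subset_univ _)
      leV := le
      leV_refl := fun _ => Or.inl rfl
      otimes := fun X c => X.down ×ˢ {c}
      oplus := fun X Y => X ∪ Y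
      oplus_assoc := Set.union_assoc
      oplus_comm := Set.union_comm
      iota := cst
      iota_injective := cst_inj
      top_otimes := fun _ => rfl
      leV_iota := by
        refine fun c d => ⟨?_, fun h => Or.inr (Or.inl ⟨c, d, rfl, rfl, h⟩)⟩
        rintro (h | ⟨c', d', hc, hd, h⟩ | ⟨a, ha, b, hb, hac, hbd, h⟩)
        · exact cst_inj h ▸ E₁.leU_refl _
        · exact cst_inj hc ▸ cst_inj hd ▸ h
        · exact (hweak a ha b hb _ _ (graph_eq_cst a c hac.symm)
            (graph_eq_cst b d hbd.symm)).1 h }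
  have hgeu : ∀ a : SimpleAct S C, geuVal E₂ ULift.up ULift.up a = graph a := fun a =>
    E₂.geu_eq_graph ULift.up (fun _ _ => rfl) (fun _ _ => rfl) _ _ _
  refine ⟨U₂, P₂, Set (S × U₂), E₂, ULift.up, ULift.up,
    ⟨rfl, rfl, fun X Y h => hmono X Y h⟩, fun _ _ => Iff.rfl, fun _ _ => Iff.rfl, ?_⟩
  intro a ha b hb
  unfold geuRel
  rw [hgeu, hgeu]
  refine ⟨fun h => Or.inr (Or.inr ⟨a, ha, b, hb, rfl, rfl, h⟩), ?_⟩
  rintro (h | ⟨c, d, hc, hd, h⟩ | ⟨a', -, b', -, haa, hbb, h⟩)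
  · exact graph_inj h ▸ hrefl a ha
  · exact (hweak a ha b hb _ _ (graph_eq_cst a c hc) (graph_eq_cst b d hd)).2 h
  · exact graph_inj haa ▸ graph_inj hbb ▸ h
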